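/- Let $k$ be an algebraically closed field of characteristic zero, let $s, t \geq 1$ and $u \geq 0$ be integers, and set $v = t + (u+1)s$. Let $d = \partial_x + x^u(x^t y^s + 1)\partial_y$, and let $B = k[x,y][1/y]$ be the localization of $k[x,y]$ at the multiplicative set of powers of $y$, with $d$ extended (uniquely) to a derivation of $B$. If $d$ is not a simple derivation of $k[x,y]$, then there exist a positive integer $n$ divisible by both $t$ and $v$, a non-negative integer $a$ divisible by $v$, and elements $a_0, \dots, a_n$ of the Laurent polynomial ring $k[y, 1/y] \subseteq B$ with $a_n = 1$, such that $g = \sum_{i=0}^{n} a_i x^i \in B$ satisfies $y\, d(g) = -a\, x^u g$. -/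

import Mathlib

open MvPolynomial

/-- A `k`-derivation `d` of `k[x,y]` is *simple* if the only `d`-differential ideals
(ideals `I` with `d(I) ⊆ I`) are `(0)` and the whole ring. Here `k[x,y]` is modelled as
`MvPolynomial (Fin 2) k`, with `x = X 0` and `y = X 1`. -/
def IsSimpleDerivation {k : Type*} [CommRing k]
    (d : Derivation k (MvPolynomial (Fin 2) k) (MvPolynomial (Fin 2) k)) : Prop :=
  ∀ I : Ideal (MvPolynomial (Fin 2) k), (∀ f ∈ I, d f ∈ I) → I = ⊥ ∨ I = ⊤

section Biv

open Polynomial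

variable {k : Type*} [Field k]

noncomputable def coeffDeriv (f : k[X][X]) : k[X][X] :=
  ∑ i ∈ f.support, Polynomial.monomial i (derivative (f.coeff i))

lemma coeffDeriv_coeff (f : k[X][X]) (i : ℕ) :
    (coeffDeriv f).coeff i = derivative (f.coeff i) := by
  simp only [coeffDeriv, finsetSum_coeff, Polynomial.coeff_monomial]
  simp +contextual

lemma deriv_formula (δ : Derivation k k[X][X] k[X][X]) (f : k[X][X]) :
    δ f = coeffDeriv f * δ (Polynomial.C Polynomial.X) + derivative f * δ Polynomial.X := by
  have hC : ∀ p : k[X], δ (Polynomial.C p) =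
      Polynomial.C (derivative p) * δ (Polynomial.C Polynomial.X) := by
    intro p
    have h := δ.map_aeval p (Polynomial.C Polynomial.X)
    have h2 : ∀ q : k[X], Polynomial.aeval (Polynomial.C Polynomial.X : k[X][X]) q
        = Polynomial.C q := by
      intro q
      have := Polynomial.aeval_algebraMap_apply k[X][X] (Polynomial.X : k[X]) q
      simpa [Polynomial.algebraMap_eq] using this
    rw [h2, h2] at h
    rw [h, smul_eq_mul]
  have hadd : ∀ p q : k[X][X], coeffDeriv (p + q) = coeffDeriv p + coeffDeriv q := by
    intro p q
    ext1 i
    simp [coeffDeriv_coeff]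
  induction f using Polynomial.induction_on' with
  | add p q hp hq => rw [map_add, hp, hq, hadd, derivative_add]; ring
  | monomial n p =>
    have : coeffDeriv (Polynomial.monomial n p) = Polynomial.monomial n (derivative p) := by
      ext1 i
      rw [coeffDeriv_coeff, Polynomial.coeff_monomial, Polynomial.coeff_monomial]
      split_ifs <;> simp
    rw [this]
    simp only [← Polynomial.C_mul_X_pow_eq_monomial]
    rw [Derivation.leibniz, hC, Derivation.leibniz_pow]
    simp only [smul_eq_mul, nsmul_eq_mul, derivative_mul, derivative_C, derivative_X_pow, map_natCast]
    ring

variable [CharZero k]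

lemma top_of_const_mem (δ : Derivation k k[X][X] k[X][X])
    (hx : δ (Polynomial.C Polynomial.X) = 1) (I : Ideal k[X][X]) (hI : ∀ f ∈ I, δ f ∈ I) :
    ∀ (n : ℕ) (c : k[X]), c.natDegree ≤ n → c ≠ 0 → Polynomial.C c ∈ I → I = ⊤ := by
  intro n
  induction n with
  | zero =>
    intro c hc hc0 h
    apply Ideal.eq_top_of_isUnit_mem _ h
    rw [Polynomial.isUnit_C, Polynomial.isUnit_iff_degree_eq_zero,
      Polynomial.degree_eq_natDegree hc0]
    simp at hc; simp [hc]
  | succ n ih =>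
    intro c hc hc0 h
    by_cases h1 : c.natDegree = 0
    · exact ih c (by omega) hc0 h
    · have hd := Polynomial.natDegree_derivative_lt (p := c) h1
      refine ih (derivative c) (by omega) ?_ ?_
      · intro h0
        exact h1 (Polynomial.derivative_eq_zero.1 h0)
      · have h2 := hI _ h
        rw [deriv_formula, hx] at h2
        convert h2 using 1
        simp
        ext1 i
        rw [coeffDeriv_coeff, Polynomial.coeff_C, Polynomial.coeff_C]
        split_ifs <;> simp

attribute [local instance] Polynomial.algebra Polynomial.isLocalization in
lemma exists_darboux (δ : Derivation k k[X][X] k[X][X])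
    (hx : δ (Polynomial.C Polynomial.X) = 1) (I : Ideal k[X][X]) (hI : ∀ f ∈ I, δ f ∈ I)
    (h0 : I ≠ ⊥) (h1 : I ≠ ⊤) : ∃ h : k[X][X], h ≠ 0 ∧ ¬ IsUnit h ∧ h ∣ δ h := by
  classical
  let _ : NormalizedGCDMonoid k[X] := UniqueFactorizationMonoid.toNormalizedGCDMonoid _
  let K := FractionRing k[X]
  let M : Submonoid k[X][X] := (nonZeroDivisors k[X]).map Polynomial.C
  have halg : ∀ p : k[X][X], algebraMap k[X][X] K[X] p = p.map (algebraMap k[X] K) := fun p => rfl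
  have hprin := (IsPrincipalIdealRing.principal (I.map (algebraMap k[X][X] K[X]))).principal
  obtain ⟨q, hq⟩ := hprin
  have hqmem : q ∈ I.map (algebraMap k[X][X] K[X]) := by
    rw [hq]; exact Submodule.mem_span_singleton_self q
  obtain ⟨⟨⟨f, hf⟩, ⟨c, hc⟩⟩, hfc⟩ :=
    (IsLocalization.mem_map_algebraMap_iff M K[X]).1 hqmem
  obtain ⟨c, hc', rfl⟩ := hc
  have hc0 : c ≠ 0 := nonZeroDivisors.ne_zero hc'
  simp only [halg, Polynomial.map_C] at hfc
  have hu : IsUnit (Polynomial.C (algebraMap k[X] K c)) := by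
    rw [Polynomial.isUnit_C, isUnit_iff_ne_zero]
    simpa using hc0
  have hdiv : ∀ i ∈ I, f.primPart ∣ i := by
    intro i hi
    apply (Polynomial.isPrimitive_primPart f).dvd_of_fraction_map_dvd_fraction_map (K := K)
    have h2 : i.map (algebraMap k[X] K) ∈ I.map (algebraMap k[X][X] K[X]) :=
      Ideal.mem_map_of_mem (algebraMap k[X][X] K[X]) hi
    rw [hq] at h2
    have h3 := Ideal.mem_span_singleton.1 h2
    refine (Polynomial.map_dvd _ (Polynomial.primPart_dvd f)).trans ?_
    rw [← hfc]
    exact hu.mul_right_dvd.2 h3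
  have hf0 : f ≠ 0 := by
    rintro rfl
    have hq0 : q = 0 := by
      simp at hfc
      exact hfc.resolve_right hc0
    apply h0
    rw [eq_bot_iff]
    intro i hi
    have h2 : i.map (algebraMap k[X] K) ∈ I.map (algebraMap k[X][X] K[X]) :=
      Ideal.mem_map_of_mem (algebraMap k[X][X] K[X]) hi
    rw [hq, hq0] at h2
    have h3 := Ideal.mem_span_singleton.1 h2
    rw [zero_dvd_iff, Polynomial.map_eq_zero_iff (IsFractionRing.injective k[X] K)] at h3
    simpa using h3
  refine ⟨f.primPart, Polynomial.primPart_ne_zero f, ?_, ?_⟩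
  · intro hu
    have h3 : f.natDegree = 0 := by
      rw [← Polynomial.natDegree_primPart]; exact Polynomial.natDegree_eq_zero_of_isUnit hu
    rw [Polynomial.natDegree_eq_zero] at h3
    obtain ⟨a, rfl⟩ := h3
    exact h1 (top_of_const_mem δ hx I hI _ a le_rfl (by simpa using hf0) hf)
  · have h4 := hdiv _ (hI f hf)
    have h5 : δ f = δ (Polynomial.C f.content * f.primPart) := by
      rw [← Polynomial.eq_C_content_mul_primPart]
    rw [h5, Derivation.leibniz, smul_eq_mul, smul_eq_mul] at h4
    have h6 := (dvd_add_left (Dvd.intro _ rfl)).1 h4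
    apply (Polynomial.isPrimitive_primPart f).dvd_of_fraction_map_dvd_fraction_map (K := K)
    have h7 := Polynomial.map_dvd (algebraMap k[X] K) h6
    rw [Polynomial.map_mul, Polynomial.map_C] at h7
    have hu2 : IsUnit (Polynomial.C (algebraMap k[X] K f.content)) := by
      rw [Polynomial.isUnit_C, isUnit_iff_ne_zero]
      simpa [Polynomial.content_eq_zero_iff] using hf0
    exact hu2.dvd_mul_left.1 h7

end Biv
section LemA

open Polynomial

variable {k : Type*} [Field k] [CharZero k]

lemma dvd_derivative_const (r : k[X]) (h : r ∣ derivative r) : r.natDegree = 0 := by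
  by_contra h0
  have h1 := Polynomial.natDegree_derivative_lt (p := r) h0
  have h2 : derivative r ≠ 0 := fun h3 => h0 (Polynomial.derivative_eq_zero.1 h3)
  have := Polynomial.natDegree_le_of_dvd h h2
  omega

lemma eq_monomial_of_dvd (L b : k[X]) (s : ℕ) (hL : L ≠ 0)
    (h : Polynomial.X ^ s * derivative L = b * L) :
    ∃ (m : ℕ) (c : k), c ≠ 0 ∧ L = Polynomial.C c * Polynomial.X ^ m := by
  obtain ⟨r, hr, hnd⟩ := Polynomial.exists_eq_pow_rootMultiplicity_mul_and_not_dvd L hL 0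
  set m := Polynomial.rootMultiplicity 0 L
  simp only [map_zero, sub_zero] at hr hnd
  have hcop : IsCoprime r Polynomial.X :=
    ((Polynomial.irreducible_X.coprime_iff_not_dvd).2 hnd).symm
  have h1 : r ∣ Polynomial.X ^ (s + m + 1) * derivative r := by
    have h2 : Polynomial.X * derivative L
        = (m : k[X]) * L + Polynomial.X ^ (m + 1) * derivative r := by
      rw [hr, derivative_mul, derivative_X_pow, map_natCast]
      rcases m with _ | m
      · simp
      · simp only [Nat.add_sub_cancel]; ring
    have h3 : Polynomial.X ^ (s + m + 1) * derivative r
       = (Polynomial.X * b - Polynomial.X ^ s * (m : k[X])) * (Polynomial.X ^ m * r) := by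
      rw [← hr]
      linear_combination (Polynomial.X : k[X]) * h - (Polynomial.X : k[X]) ^ s * h2
    rw [h3]
    exact ⟨(Polynomial.X * b - Polynomial.X ^ s * (m : k[X])) * Polynomial.X ^ m, by ring⟩
  have h2 : r ∣ derivative r := (hcop.pow_right).dvd_of_dvd_mul_left h1
  have h3 := Polynomial.eq_C_of_natDegree_eq_zero (dvd_derivative_const r h2)
  refine ⟨m, r.coeff 0, ?_, ?_⟩
  · intro h4
    rw [h4, map_zero] at h3
    apply hL; rw [hr, h3, mul_zero]
  · rw [← h3, mul_comm]; exact hr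

lemma natDegree_coeffDeriv (f : k[X][X]) : (coeffDeriv f).natDegree ≤ f.natDegree := by
  rw [Polynomial.natDegree_le_iff_coeff_eq_zero]
  intro N hN
  rw [coeffDeriv_coeff, Polynomial.coeff_eq_zero_of_natDegree_lt hN, derivative_zero]

lemma lemA (s t u : ℕ) (ht : 1 ≤ t) (δ : Derivation k k[X][X] k[X][X])
    (hX : δ Polynomial.X = 1)
    (hY : δ (Polynomial.C Polynomial.X) =
      Polynomial.X ^ u * (Polynomial.X ^ t * Polynomial.C Polynomial.X ^ s + 1))
    (f lam : k[X][X]) (hf : f ≠ 0) (h : δ f = lam * f) :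
    ∃ (m : ℕ) (c : k), c ≠ 0 ∧ f.leadingCoeff = Polynomial.C c * Polynomial.X ^ m ∧
      (∀ i, u + t ≤ i → (Polynomial.C Polynomial.X * lam - (m : k[X][X]) *
        (Polynomial.X ^ u * (Polynomial.X ^ t * Polynomial.C Polynomial.X ^ s + 1))).coeff i = 0) ∧
      (¬ IsUnit f → 0 < f.natDegree) := by
  have hw : ∀ g : k[X][X], g *
      (Polynomial.X ^ u * (Polynomial.X ^ t * Polynomial.C Polynomial.X ^ s + 1))
      = Polynomial.C (Polynomial.X ^ s) * (g * Polynomial.X ^ (u + t)) + g * Polynomial.X ^ u := by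
    intro g
    simp only [map_pow]
    ring
  have hfor := deriv_formula δ f
  rw [hX, hY, h, hw, mul_one] at hfor
  have hlam : lam.natDegree ≤ u + t := by
    by_cases hl : lam = 0
    · simp [hl]
    have h1 : (lam * f).natDegree ≤ f.natDegree + (u + t) := by
      rw [hfor]
      refine Polynomial.natDegree_add_le_of_degree_le
        (Polynomial.natDegree_add_le_of_degree_le ?_ ?_) ?_
      · refine (Polynomial.natDegree_C_mul_le _ _).trans ?_
        refine Polynomial.natDegree_mul_le.trans ?_
        have := natDegree_coeffDeriv f
        simp; omega
      · refine Polynomial.natDegree_mul_le.trans ?_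
        have := natDegree_coeffDeriv f
        simp; omega
      · have := Polynomial.natDegree_derivative_le f
        omega
    rw [Polynomial.natDegree_mul hl hf] at h1
    omega
  have key : Polynomial.X ^ s * derivative f.leadingCoeff = lam.coeff (u + t) * f.leadingCoeff := by
    have h1 := congrArg (fun p => p.coeff (u + t + f.natDegree)) hfor
    rw [Polynomial.coeff_mul_add_eq_of_natDegree_le hlam le_rfl] at h1
    rw [Polynomial.coeff_add, Polynomial.coeff_add, Polynomial.coeff_C_mul, add_comm (u + t),
      Polynomial.coeff_mul_X_pow, coeffDeriv_coeff, Polynomial.coeff_derivative,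
      Polynomial.coeff_eq_zero_of_natDegree_lt (p := f) (n := f.natDegree + (u + t) + 1) (by omega),
      show f.natDegree + (u + t) = (f.natDegree + t) + u by ring,
      Polynomial.coeff_mul_X_pow, coeffDeriv_coeff,
      Polynomial.coeff_eq_zero_of_natDegree_lt (p := f) (n := f.natDegree + t) (by omega)] at h1
    simp only [derivative_zero, zero_mul, add_zero] at h1
    exact h1.symm
  have hL0 : f.leadingCoeff ≠ 0 := by simpa using hf
  obtain ⟨m, c, hc, hL⟩ := eq_monomial_of_dvd _ _ s hL0 key
  refine ⟨m, c, hc, hL, ?_, ?_⟩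
  · intro i hi
    have hco : (Polynomial.X ^ u * (Polynomial.X ^ t * Polynomial.C Polynomial.X ^ s + 1)
        : k[X][X]).coeff i = if i = u + t then Polynomial.X ^ s else 0 := by
      have := hw 1
      rw [one_mul] at this
      rw [this, one_mul, one_mul, Polynomial.coeff_add, Polynomial.coeff_C_mul,
        Polynomial.coeff_X_pow, Polynomial.coeff_X_pow, if_neg (show ¬ i = u by omega)]
      simp
    rw [Polynomial.coeff_sub, Polynomial.coeff_C_mul, Polynomial.coeff_natCast_mul, hco]
    split_ifs with hi2
    · subst hi2
      have h2 : Polynomial.X * derivative f.leadingCoeff = (m : k[X]) * f.leadingCoeff := by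
        rw [hL, derivative_mul, derivative_X_pow, map_natCast, derivative_C]
        rcases m with _ | m
        · simp
        · simp only [Nat.add_sub_cancel]; ring
      apply mul_right_cancel₀ hL0
      linear_combination ((-Polynomial.X : k[X])) * key + Polynomial.X ^ s * h2
    · rw [Polynomial.coeff_eq_zero_of_natDegree_lt (p := lam) (by omega)]
      simp
  · intro hu
    by_contra h0
    have h0 : f.natDegree = 0 := by omega
    apply hu
    have hfC := Polynomial.eq_C_of_natDegree_eq_zero h0
    have h1 := congrArg (fun p => p.coeff u) hfor
    have h2 : f.coeff 0 ∣ derivative (f.coeff 0) := by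
      refine ⟨lam.coeff u, ?_⟩
      nth_rewrite 1 [hfC] at h1
      have e1 := Polynomial.coeff_mul_X_pow (coeffDeriv f) u 0
      rw [zero_add] at e1
      rw [Polynomial.coeff_mul_C, Polynomial.coeff_add, Polynomial.coeff_add,
        Polynomial.coeff_C_mul, e1, Polynomial.coeff_mul_X_pow', if_neg (by omega),
        Polynomial.coeff_derivative, Polynomial.coeff_eq_zero_of_natDegree_lt (p := f) (n := u + 1) (by omega),
        coeffDeriv_coeff] at h1
      simp only [mul_zero, zero_mul, add_zero, zero_add] at h1
      rw [← h1, mul_comm]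
    have h3 := dvd_derivative_const _ h2
    rw [hfC, Polynomial.isUnit_C]
    rw [Polynomial.eq_C_of_natDegree_eq_zero h3, Polynomial.isUnit_C, isUnit_iff_ne_zero]
    intro h4
    apply hf
    rw [hfC, Polynomial.eq_C_of_natDegree_eq_zero h3, h4]
    simp

lemma lemB (s t u : ℕ) (hs : 1 ≤ s) (ht : 1 ≤ t) (δ : Derivation k k[X][X] k[X][X])
    (hX : δ (Polynomial.C Polynomial.X) = 1)
    (hY : δ Polynomial.X =
      Polynomial.C Polynomial.X ^ u * (Polynomial.C Polynomial.X ^ t * Polynomial.X ^ s + 1))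
    (f mu : k[X][X]) (m : ℕ) (hm : f.coeff m ≠ 0)
    (h : Polynomial.X * δ f = (mu + (m : k[X][X]) *
      (Polynomial.C Polynomial.X ^ u * (Polynomial.C Polynomial.X ^ t * Polynomial.X ^ s + 1))) * f)
    (hmu : ∀ j i, u + t ≤ i → (mu.coeff j).coeff i = 0) :
    (∃ p : ℕ, mu.coeff 0 = -((p : k[X]) * Polynomial.X ^ u)) ∧ ∀ j, s ≤ j → mu.coeff j = 0 := by
  have hf : f ≠ 0 := by rintro rfl; simp at hm
  set P : k[X][X] := Polynomial.X * derivative f - (m : k[X][X]) * f with hP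
  have hPc : ∀ j, P.coeff j = ((j : k[X]) - m) * f.coeff j := by
    intro j
    rw [hP, Polynomial.coeff_sub, Polynomial.coeff_natCast_mul]
    rcases j with _ | j
    · simp
    · rw [Polynomial.coeff_X_mul, Polynomial.coeff_derivative]; push_cast; ring
  have hE : mu * f = coeffDeriv f * Polynomial.X +
      Polynomial.C (Polynomial.X ^ (u + t)) * (P * Polynomial.X ^ s) +
      Polynomial.C (Polynomial.X ^ u) * P := by
    rw [deriv_formula, hX, hY] at h
    simp only [map_pow, map_mul, hP, pow_add]
    linear_combination -h
  constructor
  · set l := f.natTrailingDegree with hl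
    have hlow : ∀ j < l, f.coeff j = 0 := fun j hj =>
      Polynomial.coeff_eq_zero_of_lt_natTrailingDegree hj
    have hl0 : f.coeff l ≠ 0 := by
      have := Polynomial.trailingCoeff_nonzero_iff_nonzero.2 hf
      exact this
    have hlm : l ≤ m := Polynomial.natTrailingDegree_le_of_ne_zero hm
    refine ⟨m - l, ?_⟩
    have h1 := congrArg (fun p => p.coeff l) hE
    simp only [Polynomial.coeff_add, Polynomial.coeff_C_mul] at h1
    have e1 : (mu * f).coeff l = mu.coeff 0 * f.coeff l := by
      rw [Polynomial.coeff_mul, Finset.sum_eq_single (0, l)]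
      · rintro ⟨a, b⟩ hab hne
        have hab := Finset.HasAntidiagonal.mem_antidiagonal.1 hab
        simp only at hab ⊢
        rw [hlow b, mul_zero]
        rcases Nat.eq_zero_or_pos a with h0 | h0
        · exfalso; apply hne; simp; omega
        · omega
      · intro hn; simp at hn
    have e2 : (coeffDeriv f * Polynomial.X).coeff l = 0 := by
      rcases hl' : l with _ | l'
      · simp
      · rw [Polynomial.coeff_mul_X, coeffDeriv_coeff, hlow _ (by omega), derivative_zero]
    have e3 : (P * Polynomial.X ^ s).coeff l = 0 := by
      rw [Polynomial.coeff_mul_X_pow']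
      split_ifs with h3
      · rw [hPc, hlow _ (by omega), mul_zero]
      · rfl
    rw [e1, e2, e3, hPc, mul_zero, zero_add, zero_add] at h1
    apply mul_right_cancel₀ hl0
    rw [h1]
    push_cast [hlm]
    ring
  · have hPd : P.natDegree ≤ f.natDegree := by
      rw [Polynomial.natDegree_le_iff_coeff_eq_zero]
      intro N hN
      rw [hPc, Polynomial.coeff_eq_zero_of_natDegree_lt hN, mul_zero]
    have hcd := natDegree_coeffDeriv f
    have hmus : mu.natDegree ≤ s := by
      by_cases hl : mu = 0
      · simp [hl]
      have h1 : (mu * f).natDegree ≤ f.natDegree + s := by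
        rw [hE]
        refine Polynomial.natDegree_add_le_of_degree_le
          (Polynomial.natDegree_add_le_of_degree_le ?_ ?_) ?_
        · refine Polynomial.natDegree_mul_le.trans ?_
          simp; omega
        · refine (Polynomial.natDegree_C_mul_le _ _).trans ?_
          refine Polynomial.natDegree_mul_le.trans ?_
          simp; omega
        · refine (Polynomial.natDegree_C_mul_le _ _).trans ?_
          omega
      rw [Polynomial.natDegree_mul hl hf] at h1
      omega
    set q := f.natDegree with hq
    set A := f.coeff q with hA
    have hA0 : A ≠ 0 := by
      have := Polynomial.leadingCoeff_ne_zero.2 hf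
      exact this
    have h1 := congrArg (fun p => p.coeff (s + q)) hE
    simp only [Polynomial.coeff_add, Polynomial.coeff_C_mul] at h1
    rw [Polynomial.coeff_mul_add_eq_of_natDegree_le hmus le_rfl, add_comm s q, Polynomial.coeff_mul_X_pow,
      hPc, hPc, Polynomial.coeff_eq_zero_of_natDegree_lt (p := f) (n := q + s) (by omega),
      show q + s = (q + (s - 1)) + 1 by omega,
      Polynomial.coeff_mul_X, coeffDeriv_coeff, mul_zero, mul_zero, add_zero, ← hA] at h1
    set R := derivative (f.coeff (q + (s - 1))) with hR
    have hRc : R = 0 ∨ R.natDegree < A.natDegree := by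
      by_cases hs1 : s = 1
      · by_cases hAd : A.natDegree = 0
        · left
          rw [hR, hs1]; simpa using Polynomial.derivative_eq_zero.2 hAd
        · right
          have := Polynomial.natDegree_derivative_lt (p := A) hAd
          rw [hR, hs1]; simp only [Nat.sub_self, add_zero]; exact this
      · left
        rw [hR, Polynomial.coeff_eq_zero_of_natDegree_lt (by omega), derivative_zero]
    have hRz : ∀ i, A.natDegree ≤ i → R.coeff i = 0 := by
      intro i hi
      rcases hRc with h2 | h2
      · simp [h2]
      · exact Polynomial.coeff_eq_zero_of_natDegree_lt (by omega)
    have hmd : (mu.coeff s).natDegree ≤ u + t - 1 := by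
      rw [Polynomial.natDegree_le_iff_coeff_eq_zero]
      intro N hN
      exact hmu _ _ (by omega)
    have hqm : ((q : k[X]) - m) = 0 := by
      have h2 := congrArg (fun p => p.coeff (A.natDegree + (u + t))) h1
      simp only [Polynomial.coeff_add] at h2
      rw [hRz _ (by omega), Polynomial.coeff_eq_zero_of_natDegree_lt, mul_comm (Polynomial.X ^ _),
        Polynomial.coeff_mul_X_pow] at h2
      · have h3 : (((q : k[X]) - m) * A).coeff A.natDegree = ((q : k) - m) * A.leadingCoeff := by
          rw [sub_mul, Polynomial.coeff_sub, Polynomial.coeff_natCast_mul,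
            Polynomial.coeff_natCast_mul, sub_mul]
          rfl
        rw [h3, zero_add] at h2
        have h4 := (mul_eq_zero.1 h2.symm).resolve_right (by simpa using hA0)
        have h5 : q = m := by
          have := sub_eq_zero.1 h4
          exact_mod_cast this
        rw [h5, sub_self]
      · refine lt_of_le_of_lt Polynomial.natDegree_mul_le ?_
        omega
    rw [hqm, zero_mul, mul_zero, add_zero] at h1
    have hmus0 : mu.coeff s = 0 := by
      by_contra h3
      have h4 := Polynomial.natDegree_mul h3 hA0
      rw [h1] at h4
      rcases hRc with h5 | h5
      · rw [h5] at h1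
        exact (mul_ne_zero h3 hA0) h1
      · omega
    intro j hj
    rcases hj.eq_or_lt with rfl | hj
    · exact hmus0
    · exact Polynomial.coeff_eq_zero_of_natDegree_lt (by omega)

end LemA
section LemC

variable {k : Type*} [Field k]

/-- transport of a derivation along an algebra equivalence -/
noncomputable def transportDer {A B : Type*} [CommRing A] [CommRing B] [Algebra k A] [Algebra k B]
    (e : A ≃ₐ[k] B) (d : Derivation k A A) : Derivation k B B :=
  Derivation.mk' (e.toLinearMap ∘ₗ d.toLinearMap ∘ₗ e.symm.toLinearMap) (by
    intro a b
    simp [map_mul, map_add])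

lemma transportDer_apply {A B : Type*} [CommRing A] [CommRing B] [Algebra k A] [Algebra k B]
    (e : A ≃ₐ[k] B) (d : Derivation k A A) (b : B) : transportDer e d b = e (d (e.symm b)) := rfl

noncomputable def eqvB (k : Type*) [Field k] :
    MvPolynomial (Fin 2) k ≃ₐ[k] Polynomial (Polynomial k) :=
  (Polynomial.Bivariate.equivMvPolynomial k).symm

noncomputable def eqvA (k : Type*) [Field k] :
    MvPolynomial (Fin 2) k ≃ₐ[k] Polynomial (Polynomial k) :=
  (eqvB k).trans Polynomial.Bivariate.swap

lemma eqvB_X0 : eqvB k (X 0) = Polynomial.C Polynomial.X := by simp [eqvB]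
lemma eqvB_X1 : eqvB k (X 1) = Polynomial.X := by simp [eqvB]
lemma eqvA_X0 : eqvA k (X 0) = Polynomial.X := by
  simp only [eqvA, AlgEquiv.trans_apply, eqvB_X0, Polynomial.Bivariate.swap_X]
lemma eqvA_X1 : eqvA k (X 1) = Polynomial.C Polynomial.X := by
  simp only [eqvA, AlgEquiv.trans_apply, eqvB_X1, Polynomial.Bivariate.swap_Y]

lemma swap_coeff (f : Polynomial (Polynomial k)) (i j : ℕ) :
    ((Polynomial.Bivariate.swap f).coeff i).coeff j = (f.coeff j).coeff i := by
  induction f using Polynomial.induction_on' with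
  | add p q hp hq => simp [map_add, hp, hq]
  | monomial n p =>
    induction p using Polynomial.induction_on' with
    | add p q hp hq => simp only [map_add, Polynomial.coeff_add, hp, hq]
    | monomial m a =>
      rw [Polynomial.Bivariate.swap_monomial_monomial]
      simp only [Polynomial.coeff_monomial]
      split_ifs <;> simp_all [Polynomial.coeff_monomial]

lemma eqv_coeff (f : MvPolynomial (Fin 2) k) (i j : ℕ) :
    ((eqvA k f).coeff i).coeff j = ((eqvB k f).coeff j).coeff i := by
  rw [eqvA, AlgEquiv.trans_apply, swap_coeff]

noncomputable def wpoly (k : Type*) [Field k] (s t u : ℕ) : MvPolynomial (Fin 2) k :=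
  X 0 ^ u * (X 0 ^ t * X 1 ^ s + 1)

noncomputable def der (k : Type*) [Field k] (s t u : ℕ) :
    Derivation k (MvPolynomial (Fin 2) k) (MvPolynomial (Fin 2) k) :=
  MvPolynomial.mkDerivation k ![1, X 0 ^ u * (X 0 ^ t * X 1 ^ s + 1)]

lemma der_X0 (s t u : ℕ) : der k s t u (X 0) = 1 := by simp [der]
lemma der_X1 (s t u : ℕ) : der k s t u (X 1) = wpoly k s t u := by simp [der, wpoly]

/-- the diagonal automorphism -/
noncomputable def sig (u : ℕ) (ε : k) : MvPolynomial (Fin 2) k →ₐ[k] MvPolynomial (Fin 2) k :=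
  MvPolynomial.aeval ![C ε * X 0, C (ε ^ (u + 1)) * X 1]

lemma sig_X0 (u : ℕ) (ε : k) : sig u ε (X 0) = C ε * X 0 := by simp [sig]
lemma sig_X1 (u : ℕ) (ε : k) : sig u ε (X 1) = C (ε ^ (u + 1)) * X 1 := by simp [sig]
lemma sig_C (u : ℕ) (ε c : k) : sig u ε (C c) = C c := by
  simp [sig, MvPolynomial.algebraMap_eq]

lemma sig_comp (u : ℕ) (ε η : k) (h : ε * η = 1) (f : MvPolynomial (Fin 2) k) :
    sig u ε (sig u η f) = f := by
  have : (sig u ε).comp (sig u η) = AlgHom.id k _ := by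
    apply MvPolynomial.algHom_ext
    intro i
    fin_cases i
    · simp only [Fin.zero_eta, AlgHom.comp_apply, sig_X0, map_mul, sig_C, AlgHom.id_apply]
      rw [← mul_assoc, ← C_mul, mul_comm η, h, C_1, one_mul]
    · simp only [Fin.mk_one, AlgHom.comp_apply, sig_X1, map_mul, sig_C, AlgHom.id_apply]
      rw [← mul_assoc, ← C_mul, mul_comm (η ^ _), ← mul_pow, h, one_pow, C_1, one_mul]
  exact DFunLike.congr_fun this f

lemma sig_wpoly (s t u : ℕ) (ε : k) (h : ε ^ (t + (u + 1) * s) = 1) :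
    sig u ε (wpoly k s t u) = C (ε ^ u) * wpoly k s t u := by
  have h2 : (C ε : MvPolynomial (Fin 2) k) ^ (t + (u + 1) * s) = 1 := by rw [← C_pow, h, C_1]
  simp only [wpoly, map_mul, map_pow, map_add, map_one, sig_X0, sig_X1, mul_pow]
  linear_combination (C ε ^ u * X 0 ^ u * X 0 ^ t * X 1 ^ s : MvPolynomial (Fin 2) k) * h2

lemma der_sig (s t u : ℕ) (ε : k) (h : ε ^ (t + (u + 1) * s) = 1) (f : MvPolynomial (Fin 2) k) :
    der k s t u (sig u ε f) = C ε * sig u ε (der k s t u f) := by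
  induction f using MvPolynomial.induction_on with
  | C a =>
    rw [sig_C, ← MvPolynomial.algebraMap_eq, Derivation.map_algebraMap, map_zero, mul_zero]
  | add p q hp hq => rw [map_add, map_add, hp, hq, map_add, map_add, mul_add]
  | mul_X p i hp =>
    have hX : der k s t u (sig u ε (X i)) = C ε * sig u ε (der k s t u (X i)) := by
      have hCd : ∀ c : k, der k s t u (C c) = 0 := by
        intro c
        rw [← MvPolynomial.algebraMap_eq, Derivation.map_algebraMap]
      fin_cases i
      · simp only [Fin.zero_eta, sig_X0, Derivation.leibniz, hCd, der_X0, map_one, mul_zero,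
          add_zero, smul_eq_mul]
      · simp only [Fin.mk_one, sig_X1, Derivation.leibniz, hCd, der_X1, mul_zero,
          add_zero, smul_eq_mul]
        rw [sig_wpoly s t u ε h, ← mul_assoc, ← C_mul, pow_succ']
    rw [map_mul, Derivation.leibniz, Derivation.leibniz, hp, hX]
    simp only [smul_eq_mul, map_add, map_mul]
    ring

lemma der_prod {R : Type*} [CommRing R] [Algebra k R] (d : Derivation k R R) {ι : Type*}
    (S : Finset ι) (F l : ι → R) (h : ∀ e ∈ S, d (F e) = l e * F e) :
    d (∏ e ∈ S, F e) = (∑ e ∈ S, l e) * ∏ e ∈ S, F e := by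
  classical
  induction S using Finset.induction_on with
  | empty => simp
  | insert a S ha ih =>
    rw [Finset.prod_insert ha, Finset.sum_insert ha, Derivation.leibniz, h a (by simp),
      ih (fun e he => h e (by simp [he]))]
    simp only [smul_eq_mul]
    ring

lemma root_sum (s t u i j : ℕ) (ht : 1 ≤ t) (hi : i < u + t) (hj : j < s)
    (ζ : k) (hζ : IsPrimitiveRoot ζ (t + (u + 1) * s)) :
    ∑ e ∈ Finset.range (t + (u + 1) * s), (ζ ^ e) ^ (i + (u + 1) * j) * ((ζ ^ e) ^ u)⁻¹
      = if j = 0 ∧ i = u then ((t + (u + 1) * s : ℕ) : k) else 0 := by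
  have hv : (t + (u + 1) * s) ≠ 0 := by omega
  have h0 : ζ ≠ 0 := hζ.ne_zero hv
  set z := ζ ^ (i + (u + 1) * j) * (ζ ^ u)⁻¹ with hz
  have hsum : ∀ e, (ζ ^ e) ^ (i + (u + 1) * j) * ((ζ ^ e) ^ u)⁻¹ = z ^ e := by
    intro e
    rw [hz, mul_pow, inv_pow, ← pow_mul, ← pow_mul, ← pow_mul, ← pow_mul, mul_comm e, mul_comm e]
  simp only [hsum]
  split_ifs with hc
  · obtain ⟨rfl, rfl⟩ := hc
    have : z = 1 := by
      rw [hz, mul_zero, add_zero, mul_inv_cancel₀ (pow_ne_zero _ h0)]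
    simp [this]
  · have hz1 : z ≠ 1 := by
      intro h1
      have h2 : ζ ^ (i + (u + 1) * j) = ζ ^ u := by
        rw [hz] at h1
        exact (mul_inv_eq_one₀ (pow_ne_zero _ h0)).1 h1
      obtain ⟨s', rfl⟩ : ∃ s', s = s' + 1 := ⟨s - 1, by omega⟩
      have hle : (u + 1) * j ≤ (u + 1) * s' := Nat.mul_le_mul_left _ (by omega)
      have h3 := hζ.pow_inj (i := i + (u + 1) * j) (j := u) (by rw [Nat.mul_succ]; omega)
        (by rw [Nat.mul_succ]; omega) h2
      rcases Nat.eq_zero_or_pos j with h4 | h4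
      · subst h4
        exact hc ⟨rfl, by simpa using h3⟩
      · have : (u + 1) * 1 ≤ (u + 1) * j := Nat.mul_le_mul_left _ h4
        omega
    have hzv : z ^ (t + (u + 1) * s) = 1 := by
      rw [← hsum, hζ.pow_eq_one]; simp
    rw [geom_sum_eq hz1, hzv, sub_self, zero_div]

lemma expand (f : MvPolynomial (Fin 2) k) (a b : ℕ)
    (hb : ∀ j, b ≤ j → (eqvB k f).coeff j = 0)
    (ha : ∀ j i, a ≤ i → ((eqvB k f).coeff j).coeff i = 0) :
    f = ∑ j ∈ Finset.range b, ∑ i ∈ Finset.range a,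
      C (((eqvB k f).coeff j).coeff i) * (X 0 ^ i * X 1 ^ j) := by
  have hC : ∀ c : k, eqvB k (C c) = Polynomial.C (Polynomial.C c) := by
    intro c; simp [eqvB]
  apply (eqvB k).injective
  simp only [map_sum, map_mul, map_pow, eqvB_X0, eqvB_X1, hC]
  ext j i
  simp only [Polynomial.finsetSum_coeff]
  simp only [← map_pow, ← mul_assoc, ← map_mul, Polynomial.coeff_C_mul_X_pow]
  have : ∀ x y : ℕ, (if j = x then Polynomial.C (((eqvB k f).coeff x).coeff y) * Polynomial.X ^ y
      else 0).coeff i = if j = x then (if i = y then ((eqvB k f).coeff x).coeff y else 0) else 0 := by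
    intro x y
    split_ifs with h1 h2 <;> simp [Polynomial.coeff_X_pow, *]
  simp only [this]
  by_cases hj : j < b
  · rw [Finset.sum_eq_single j]
    · by_cases hi : i < a
      · rw [Finset.sum_eq_single i] <;> simp +contextual [hi, eq_comm]
      · rw [Finset.sum_eq_zero, ha _ _ (by omega)]
        intro y hy
        simp at hy
        rw [if_pos rfl, if_neg (by omega)]
    · intro x _ hx
      simp [Ne.symm hx]
    · simp [hj]
  · rw [hb j (by omega), Polynomial.coeff_zero, Finset.sum_eq_zero]
    intro x hx
    simp at hx
    simp [show j ≠ x by omega]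

lemma avg (s t u p : ℕ) (hs : 1 ≤ s) (ht : 1 ≤ t) (f : MvPolynomial (Fin 2) k)
    (ζ : k) (hζ : IsPrimitiveRoot ζ (t + (u + 1) * s))
    (hb : ∀ j, s ≤ j → (eqvB k f).coeff j = 0)
    (ha : ∀ j i, u + t ≤ i → ((eqvB k f).coeff j).coeff i = 0)
    (hp : (eqvB k f).coeff 0 = -((p : Polynomial k) * Polynomial.X ^ u)) :
    ∑ e ∈ Finset.range (t + (u + 1) * s), C (((ζ ^ e) ^ u)⁻¹) * sig u (ζ ^ e) f
      = - ((((t + (u + 1) * s) * p : ℕ) : MvPolynomial (Fin 2) k) * X 0 ^ u) := by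
  have hf := expand f (u + t) s hb ha
  set c : ℕ → ℕ → k := fun j i => ((eqvB k f).coeff j).coeff i with hc
  have hf : f = ∑ j ∈ Finset.range s, ∑ i ∈ Finset.range (u + t),
      C (c j i) * (X 0 ^ i * X 1 ^ j) := hf
  have hsig : ∀ e, C (((ζ ^ e) ^ u)⁻¹) * sig u (ζ ^ e) f = ∑ j ∈ Finset.range s,
      ∑ i ∈ Finset.range (u + t), C ((ζ ^ e) ^ (i + (u + 1) * j) * ((ζ ^ e) ^ u)⁻¹) *
        (C (c j i) * (X 0 ^ i * X 1 ^ j)) := by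
    intro e
    conv_lhs => rw [hf]
    simp only [map_sum, Finset.mul_sum]
    refine Finset.sum_congr rfl fun j _ => Finset.sum_congr rfl fun i _ => ?_
    simp only [map_mul, map_pow, sig_C, sig_X0, sig_X1]
    ring
  simp only [hsig]
  rw [Finset.sum_comm]
  have h2 : ∀ j ∈ Finset.range s, ∑ e ∈ Finset.range (t + (u + 1) * s),
      ∑ i ∈ Finset.range (u + t), C ((ζ ^ e) ^ (i + (u + 1) * j) * ((ζ ^ e) ^ u)⁻¹) *
        (C (c j i) * (X 0 ^ i * X 1 ^ j) : MvPolynomial (Fin 2) k) =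
      ∑ i ∈ Finset.range (u + t), C (if j = 0 ∧ i = u then ((t + (u + 1) * s : ℕ) : k) else 0) *
        (C (c j i) * (X 0 ^ i * X 1 ^ j)) := by
    intro j hj
    rw [Finset.sum_comm]
    refine Finset.sum_congr rfl fun i hi => ?_
    rw [← Finset.sum_mul, ← map_sum, root_sum s t u i j ht (by simpa using hi) (by simpa using hj) ζ hζ]
  rw [Finset.sum_congr rfl h2, Finset.sum_eq_single 0, Finset.sum_eq_single u]
  · have : c 0 u = -(p : k) := by
      simp only [hc]
      rw [hp, Polynomial.coeff_neg, Polynomial.coeff_natCast_mul, Polynomial.coeff_X_pow]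
      simp
    rw [this]
    simp only [and_self, if_true, pow_zero, mul_one, map_natCast, map_neg]
    push_cast
    ring
  · intro i _ hi
    simp [hi]
  · intro h; simp at h; omega
  · intro j _ hj
    simp [hj]
  · intro h; simp at h; omega

end LemC
section Main

variable {k : Type*} [Field k] [CharZero k]

lemma lemA' (s t u : ℕ) (ht : 1 ≤ t) (f lam : MvPolynomial (Fin 2) k) (hf : f ≠ 0)
    (h : der k s t u f = lam * f) :
    ∃ (m : ℕ) (c : k), c ≠ 0 ∧
      (eqvA k f).leadingCoeff = Polynomial.C c * Polynomial.X ^ m ∧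
      (∀ i, u + t ≤ i → (eqvA k (X 1 * lam - (m : MvPolynomial (Fin 2) k) *
        wpoly k s t u)).coeff i = 0) ∧
      (¬ IsUnit f → 0 < (eqvA k f).natDegree) := by
  obtain ⟨m, c, hc, h1, h2, h3⟩ := lemA s t u ht (transportDer (eqvA k) (der k s t u))
    (by rw [transportDer_apply, ← eqvA_X0, AlgEquiv.symm_apply_apply, der_X0, map_one])
    (by
      rw [transportDer_apply, ← eqvA_X1, AlgEquiv.symm_apply_apply, der_X1, wpoly]
      simp only [map_mul, map_pow, map_add, map_one, eqvA_X0])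
    (eqvA k f) (eqvA k lam) (by simpa using hf)
    (by rw [transportDer_apply, AlgEquiv.symm_apply_apply, h, map_mul])
  refine ⟨m, c, hc, h1, ?_, ?_⟩
  · intro i hi
    rw [← h2 i hi]
    simp only [map_sub, map_mul, map_natCast, wpoly, map_pow, map_add, map_one, eqvA_X0, eqvA_X1]
  · intro hu
    exact h3 (by simpa using hu)

lemma lemB' (s t u : ℕ) (hs : 1 ≤ s) (ht : 1 ≤ t) (f mu : MvPolynomial (Fin 2) k) (m : ℕ)
    (hm : (eqvB k f).coeff m ≠ 0)
    (h : X 1 * der k s t u f = (mu + (m : MvPolynomial (Fin 2) k) * wpoly k s t u) * f)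
    (hmu : ∀ j i, u + t ≤ i → ((eqvB k mu).coeff j).coeff i = 0) :
    (∃ p : ℕ, (eqvB k mu).coeff 0 = -((p : Polynomial k) * Polynomial.X ^ u)) ∧
      ∀ j, s ≤ j → (eqvB k mu).coeff j = 0 := by
  apply lemB s t u hs ht (transportDer (eqvB k) (der k s t u))
    (by rw [transportDer_apply, ← eqvB_X0, AlgEquiv.symm_apply_apply, der_X0, map_one])
    (by
      rw [transportDer_apply, ← eqvB_X1, AlgEquiv.symm_apply_apply, der_X1, wpoly]
      simp only [map_mul, map_pow, map_add, map_one, eqvB_X0])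
    (eqvB k f) (eqvB k mu) m hm _ hmu
  have h2 := congrArg (eqvB k) h
  rw [transportDer_apply, AlgEquiv.symm_apply_apply]
  simpa only [map_mul, map_natCast, wpoly, map_pow, map_add, map_one, eqvB_X0, eqvB_X1] using h2

lemma exists_poly [IsAlgClosed k] (s t u : ℕ) (hs : 1 ≤ s) (ht : 1 ≤ t)
    (hns : ¬ IsSimpleDerivation (der k s t u)) :
    ∃ (H lam : MvPolynomial (Fin 2) k) (m p : ℕ) (c : k), c ≠ 0 ∧
      der k s t u H = lam * H ∧
      X 1 * lam = (m : MvPolynomial (Fin 2) k) * wpoly k s t u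
        - (p : MvPolynomial (Fin 2) k) * X 0 ^ u ∧
      (eqvA k H).leadingCoeff = Polynomial.C c * Polynomial.X ^ m ∧
      0 < (eqvA k H).natDegree := by
  -- a Darboux polynomial
  have hF : ∃ F lam : MvPolynomial (Fin 2) k, F ≠ 0 ∧ ¬ IsUnit F ∧ der k s t u F = lam * F := by
    unfold IsSimpleDerivation at hns
    push Not at hns
    obtain ⟨I, hI, h0, h1⟩ := hns
    obtain ⟨h, hh0, hhu, l, hl⟩ := exists_darboux (transportDer (eqvB k) (der k s t u))
      (by rw [transportDer_apply, ← eqvB_X0, AlgEquiv.symm_apply_apply, der_X0, map_one])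
      (I.comap (eqvB k).symm) (by
        intro f hf
        rw [Ideal.mem_comap] at hf ⊢
        rw [transportDer_apply, AlgEquiv.symm_apply_apply]
        exact hI _ hf)
      (by
        intro hb
        apply h0
        rw [eq_bot_iff]
        intro x hx
        have : eqvB k x ∈ I.comap (eqvB k).symm := by
          rw [Ideal.mem_comap, AlgEquiv.symm_apply_apply]; exact hx
        rw [hb] at this
        simpa using this)
      (by
        intro hb
        apply h1
        rw [Ideal.eq_top_iff_one] at hb ⊢
        simpa using hb)
    refine ⟨(eqvB k).symm h, (eqvB k).symm l, by simpa using hh0, by simpa using hhu, ?_⟩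
    rw [transportDer_apply] at hl
    apply (eqvB k).injective
    rw [hl]
    simp [mul_comm]
  obtain ⟨F, lam, hF0, hFu, hF⟩ := hF
  obtain ⟨m, c, hc, hlc, hdeg, hpos⟩ := lemA' s t u ht F lam hF0 hF
  set mu := X 1 * lam - (m : MvPolynomial (Fin 2) k) * wpoly k s t u with hmu
  have hmu1 : ∀ j i, u + t ≤ i → ((eqvB k mu).coeff j).coeff i = 0 := by
    intro j i hi
    rw [← eqv_coeff, hdeg i hi, Polynomial.coeff_zero]
  obtain ⟨⟨p, hp⟩, hmu2⟩ := lemB' s t u hs ht F mu m (by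
      intro h0
      have h1 := eqv_coeff F (eqvA k F).natDegree m
      rw [h0, Polynomial.coeff_zero] at h1
      change (eqvA k F).leadingCoeff.coeff m = 0 at h1
      rw [hlc] at h1
      simp at h1
      exact hc h1)
    (by rw [hF, hmu]; ring) hmu1
  -- average
  set v := t + (u + 1) * s with hv
  have hv0 : v ≠ 0 := by omega
  have : NeZero (v : k) := ⟨by exact_mod_cast hv0⟩
  obtain ⟨ζ, hζ⟩ := HasEnoughRootsOfUnity.exists_primitiveRoot k v
  have hζ0 : ζ ≠ 0 := hζ.ne_zero hv0
  have havg := avg s t u p hs ht mu ζ hζ hmu2 hmu1 hp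
  rw [← hv] at havg
  set H := ∏ e ∈ Finset.range v, sig u (ζ ^ e) F with hH
  set lamH := ∑ e ∈ Finset.range v, C (ζ ^ e) * sig u (ζ ^ e) lam with hlamH
  have hev : ∀ e, (ζ ^ e) ^ (t + (u + 1) * s) = 1 := by
    intro e
    rw [← pow_mul, mul_comm, pow_mul, hζ.pow_eq_one, one_pow]
  have hdH : der k s t u H = lamH * H := by
    apply der_prod
    intro e _
    rw [der_sig s t u _ (hev e), hF, map_mul, mul_assoc]
  have hXl : X 1 * lamH = ((v * m : ℕ) : MvPolynomial (Fin 2) k) * wpoly k s t u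
      - ((v * p : ℕ) : MvPolynomial (Fin 2) k) * X 0 ^ u := by
    have h1 : ∀ e ∈ Finset.range v, X 1 * (C (ζ ^ e) * sig u (ζ ^ e) lam) =
        C (((ζ ^ e) ^ u)⁻¹) * sig u (ζ ^ e) mu
          + (m : MvPolynomial (Fin 2) k) * wpoly k s t u := by
      intro e _
      have h2 : C (((ζ ^ e) ^ u)⁻¹) * C ((ζ ^ e) ^ u) = (1 : MvPolynomial (Fin 2) k) := by
        rw [← C_mul, inv_mul_cancel₀ (pow_ne_zero _ (pow_ne_zero _ hζ0)), C_1]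
      rw [hmu, map_sub, map_mul, map_mul, map_natCast, sig_wpoly s t u _ (hev e), sig_X1,
        pow_succ, C_mul]
      linear_combination (-(X 1 * C (ζ ^ e) * sig u (ζ ^ e) lam) +
        (m : MvPolynomial (Fin 2) k) * wpoly k s t u) * h2
    rw [hlamH, Finset.mul_sum, Finset.sum_congr rfl h1, Finset.sum_add_distrib, havg]
    simp only [Finset.sum_const, Finset.card_range, nsmul_eq_mul]
    push_cast
    ring
  have hH0 : H ≠ 0 := by
    rw [hH, Finset.prod_ne_zero_iff]
    intro e _ h0
    apply hF0
    rw [← sig_comp u (ζ ^ e)⁻¹ (ζ ^ e) (inv_mul_cancel₀ (pow_ne_zero _ hζ0)) F, h0, map_zero]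
  have hHu : ¬ IsUnit H := by
    intro hu
    have h1 : sig u (ζ ^ 0) F ∣ H := Finset.dvd_prod_of_mem _ (by simp; omega)
    have h2 := isUnit_of_dvd_unit h1 hu
    apply hFu
    have h3 : sig u (ζ ^ 0) F = F := by
      have := sig_comp u (1 : k) 1 (by simp) F
      have h4 : (sig u (1 : k)) = AlgHom.id k _ := by
        apply MvPolynomial.algHom_ext
        intro i
        fin_cases i <;> simp [sig]
      rw [pow_zero, h4]; rfl
    rwa [h3] at h2
  obtain ⟨m', c', hc', hlc', hdeg', hpos'⟩ := lemA' s t u ht H lamH hH0 hdH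
  have hmm : m' = v * m := by
    have h1 := hdeg' (u + t) le_rfl
    rw [hXl] at h1
    have h2 : (eqvA k (((v * m : ℕ) : MvPolynomial (Fin 2) k) * wpoly k s t u
      - ((v * p : ℕ) : MvPolynomial (Fin 2) k) * X 0 ^ u
      - (m' : MvPolynomial (Fin 2) k) * wpoly k s t u)) =
      Polynomial.C ((((v * m : ℕ) : Polynomial k) - (m' : Polynomial k)) * Polynomial.X ^ s) *
        Polynomial.X ^ (u + t) +
      Polynomial.C (((v * m : ℕ) : Polynomial k) - (m' : Polynomial k) - ((v * p : ℕ) : Polynomial k)) *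
        Polynomial.X ^ u := by
      simp only [map_sub, map_mul, map_natCast, wpoly, map_pow, map_add, map_one, eqvA_X0, eqvA_X1]
      ring
    rw [h2, Polynomial.coeff_add, Polynomial.coeff_C_mul_X_pow, Polynomial.coeff_C_mul_X_pow,
      if_pos rfl, if_neg (by omega), add_zero] at h1
    have h3 := (mul_eq_zero.1 h1).resolve_right (pow_ne_zero _ Polynomial.X_ne_zero)
    have h4 := sub_eq_zero.1 h3
    have h5 : v * m = m' := by exact_mod_cast h4
    exact h5.symm
  refine ⟨H, lamH, v * m, v * p, c', hc', hdH, hXl, ?_, hpos' hHu⟩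
  rw [hlc', hmm]

end Main

/-- if `d = ∂ₓ + xᵘ(xᵗyˢ+1)∂_y` is not simple then, in the localization
`B = k[x,y][1/y]` (with `d` extended to `B`, i.e. for any derivation `D` of `B`
agreeing with `d` on `k[x,y]`), there is a Darboux element
`g = ∑ aᵢ xⁱ` with Laurent-polynomial coefficients `aᵢ ∈ k[y,1/y]`, `aₙ = 1`,
satisfying `y·D(g) = -a·xᵘ·g`, where `t ∣ n`, `v ∣ n`, `v ∣ a`. -/
theorem darboux_element_in_localization
    (k : Type*) [Field k] [CharZero k] [IsAlgClosed k]
    (s t u : ℕ) (hs : 1 ≤ s) (ht : 1 ≤ t)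
    (v : ℕ) (hv : v = t + (u + 1) * s)
    (hns : ¬ IsSimpleDerivation
      (MvPolynomial.mkDerivation k ![1, X 0 ^ u * (X 0 ^ t * X 1 ^ s + 1)])) :
    ∀ D : Derivation k (Localization.Away (X 1 : MvPolynomial (Fin 2) k))
        (Localization.Away (X 1 : MvPolynomial (Fin 2) k)),
      (∀ f : MvPolynomial (Fin 2) k,
        D (algebraMap (MvPolynomial (Fin 2) k) (Localization.Away (X 1 : MvPolynomial (Fin 2) k)) f) =
          algebraMap (MvPolynomial (Fin 2) k) (Localization.Away (X 1 : MvPolynomial (Fin 2) k))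
            ((MvPolynomial.mkDerivation k
              (![1, X 0 ^ u * (X 0 ^ t * X 1 ^ s + 1)] : Fin 2 → MvPolynomial (Fin 2) k)) f)) →
      ∃ (n a : ℕ) (aa : ℕ → Localization.Away (X 1 : MvPolynomial (Fin 2) k)),
        0 < n ∧ t ∣ n ∧ v ∣ n ∧ v ∣ a ∧
        (∀ i, aa i ∈ Algebra.adjoin k
          {algebraMap (MvPolynomial (Fin 2) k) (Localization.Away (X 1 : MvPolynomial (Fin 2) k)) (X 1),
           IsLocalization.Away.invSelf
             (S := Localization.Away (X 1 : MvPolynomial (Fin 2) k))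
             (X 1 : MvPolynomial (Fin 2) k)}) ∧
        aa n = 1 ∧
        ∃ g : Localization.Away (X 1 : MvPolynomial (Fin 2) k),
          g = ∑ i ∈ Finset.range (n + 1),
                aa i * algebraMap (MvPolynomial (Fin 2) k)
                  (Localization.Away (X 1 : MvPolynomial (Fin 2) k)) (X 0) ^ i ∧
          algebraMap (MvPolynomial (Fin 2) k)
              (Localization.Away (X 1 : MvPolynomial (Fin 2) k)) (X 1) * D g =
            - ((a : Localization.Away (X 1 : MvPolynomial (Fin 2) k)) *
                algebraMap (MvPolynomial (Fin 2) k)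
                  (Localization.Away (X 1 : MvPolynomial (Fin 2) k)) (X 0) ^ u * g) := by
  intro D hD
  obtain ⟨H, lam, m, p, c, hc, hH, hlam, hlc, hpos⟩ := exists_poly s t u hs ht hns
  set B := Localization.Away (X 1 : MvPolynomial (Fin 2) k) with hB
  set φ := algebraMap (MvPolynomial (Fin 2) k) B with hφ
  set yi : B := IsLocalization.Away.invSelf (S := B) (X 1 : MvPolynomial (Fin 2) k) with hyi
  have hy : φ (X 1) * yi = 1 := IsLocalization.Away.mul_invSelf (X 1 : MvPolynomial (Fin 2) k)
  have hDw : D (φ (X 1)) = φ (wpoly k s t u) := by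
    rw [hD]; congr 1; exact der_X1 s t u
  have hDH : D (φ H) = φ lam * φ H := by
    rw [hD, ← map_mul]; congr 1
  set N := v * t with hN
  have hv0 : 0 < v := by rw [hv]; omega
  have hN0 : 0 < N := Nat.mul_pos hv0 ht
  set Q := eqvA k (H ^ N) with hQ
  have hQn : Q.natDegree = N * (eqvA k H).natDegree := by
    rw [hQ, map_pow, Polynomial.natDegree_pow]
  have hQl : Q.leadingCoeff = Polynomial.C (c ^ N) * Polynomial.X ^ (m * N) := by
    rw [hQ, map_pow, Polynomial.leadingCoeff_pow, hlc, mul_pow, ← map_pow, ← pow_mul]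
  set z : B := algebraMap k B (c ^ N)⁻¹ * yi ^ (m * N) with hz
  -- inclusion of `k[y]`
  set ι : Polynomial k →ₐ[k] B := Polynomial.aeval (φ (X 1)) with hι
  have hφQ : ∀ G : MvPolynomial (Fin 2) k,
      φ G = (eqvA k G).eval₂ (ι : Polynomial k →+* B) (φ (X 0)) := by
    intro G
    induction G using MvPolynomial.induction_on with
    | C a =>
      have h1 : (C a : MvPolynomial (Fin 2) k) = algebraMap k _ a := rfl
      have h2 : algebraMap k (Polynomial (Polynomial k)) a = Polynomial.C (Polynomial.C a) := rfl
      rw [h1, AlgEquiv.commutes, h2, Polynomial.eval₂_C]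
      simp only [hι, RingHom.coe_coe, Polynomial.aeval_C]
      rw [hφ, ← IsScalarTower.algebraMap_apply]
    | add p q hp hq => rw [map_add, map_add, Polynomial.eval₂_add, hp, hq]
    | mul_X q i hq =>
      rw [map_mul, map_mul, Polynomial.eval₂_mul, hq]
      congr 1
      fin_cases i
      · simp only [Fin.zero_eta, eqvA_X0, Polynomial.eval₂_X]
      · simp only [Fin.mk_one, eqvA_X1, Polynomial.eval₂_C, hι, RingHom.coe_coe,
          Polynomial.aeval_X]
  have hzl : z * ι Q.leadingCoeff = 1 := by
    have h3 : ι Q.leadingCoeff = algebraMap k B (c ^ N) * φ (X 1) ^ (m * N) := by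
      rw [hQl, hι]; simp only [map_mul, map_pow, Polynomial.aeval_C, Polynomial.aeval_X]
    rw [h3, hz]
    have h1 : algebraMap k B (c ^ N)⁻¹ * algebraMap k B (c ^ N) = 1 := by
      rw [← map_mul, inv_mul_cancel₀ (pow_ne_zero _ hc), map_one]
    have h2 : φ (X 1) ^ (m * N) * yi ^ (m * N) = 1 := by rw [← mul_pow, hy, one_pow]
    linear_combination (φ (X 1) ^ (m * N) * yi ^ (m * N)) * h1 + h2
  refine ⟨Q.natDegree, N * p, fun i => z * ι (Q.coeff i), ?_, ?_, ?_, ?_, ?_, ?_, z * φ (H ^ N),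
    ?_, ?_⟩
  · rw [hQn]; exact Nat.mul_pos hN0 hpos
  · rw [hQn, hN]; exact ((dvd_mul_left t v).mul_right _)
  · rw [hQn, hN]; exact ((dvd_mul_right v t).mul_right _)
  · rw [hN]; exact ((dvd_mul_right v t).mul_right _)
  · intro i
    set S := Algebra.adjoin k {φ (X 1), yi}
    have hy1 : φ (X 1) ∈ S := Algebra.subset_adjoin (by simp)
    have hy2 : yi ∈ S := Algebra.subset_adjoin (by simp)
    refine S.mul_mem (S.mul_mem (S.algebraMap_mem _) (S.pow_mem hy2 _)) ?_
    have : ι (Q.coeff i) ∈ Algebra.adjoin k {φ (X 1)} := Polynomial.aeval_mem_adjoin_singleton k _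
    exact Algebra.adjoin_mono (by simp) this
  · exact hzl
  · rw [hφQ, ← hQ, Polynomial.eval₂_eq_sum_range, Finset.mul_sum]
    refine Finset.sum_congr rfl fun i _ => ?_
    change z * (ι (Q.coeff i) * φ (X 0) ^ i) = z * ι (Q.coeff i) * φ (X 0) ^ i
    ring
  · have hDyi : φ (X 1) * D yi = - (yi * φ (wpoly k s t u)) := by
      have h1 := congrArg D hy
      rw [Derivation.leibniz, hDw, Derivation.map_one_eq_zero, smul_eq_mul, smul_eq_mul] at h1
      linear_combination h1
    have hpow : ∀ (b w : B) (n : ℕ), φ (X 1) * D b = w * b → φ (X 1) * D (b ^ n) = n * w * b ^ n := by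
      intro b w n hb
      induction n with
      | zero => simp
      | succ n ih =>
        rw [pow_succ, Derivation.leibniz, smul_eq_mul, smul_eq_mul]
        push_cast
        linear_combination b ^ n * hb + b * ih
    have e1 := hpow yi (-φ (wpoly k s t u)) (m * N) (by rw [hDyi]; ring)
    have hlam' := congrArg φ hlam
    rw [map_mul, map_sub, map_mul, map_mul, map_natCast, map_natCast, map_pow] at hlam'
    have e2 := hpow (φ H) (φ (X 1) * φ lam) N (by rw [hDH]; ring)
    rw [hlam'] at e2
    have hDC : ∀ (a : k) (b : B), D (algebraMap k B a * b) = algebraMap k B a * D b := by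
      intro a b
      rw [← Algebra.smul_def, Derivation.map_smul, Algebra.smul_def]
    rw [map_pow, hz, mul_assoc (algebraMap k B (c ^ N)⁻¹), hDC, Derivation.leibniz,
      smul_eq_mul, smul_eq_mul]
    have hcast : ((m * N : ℕ) : B) = (m : B) * (N : B) := Nat.cast_mul m N
    rw [hcast] at e1
    push_cast
    linear_combination (algebraMap k B (c ^ N)⁻¹ * yi ^ (m * N)) * e2 +
      (algebraMap k B (c ^ N)⁻¹ * φ H ^ N) * e1
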